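/- arXiv:2406.07039 — 4 statements merged into one kernel-verified Lean document; each statement's English description precedes it below -/
import Mathlib

section
/- Let V be a real inner product space and T : V × V → V a bilinear map such that the trilinear form (x,y,z) ↦ ⟨T(x,y), z⟩ is alternating (totally skew-symmetric). If ⟨T(x,y),T(z,v)⟩ + ⟨T(y,z),T(x,v)⟩ + ⟨T(z,x),T(y,v)⟩ = 0 for all x,y,z,v ∈ V, then T satisfies the Jacobi identity: T(T(x,y),z) + T(T(y,z),x) + T(T(z,x),y) = 0 for all x,y,z ∈ V. In particular, V equipped with the bracket T is a real Lie algebra on which the inner product is invariant, i.e. ⟨T(v,w₁),w₂⟩ = −⟨w₁,T(v,w₂)⟩ for all v,w₁,w₂ ∈ V. -/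
open scoped RealInnerProductSpace

/-- If a bilinear map `T` on a real inner product space has totally skew-symmetric
associated trilinear form `⟪T x y, z⟫` and satisfies the quadratic identity
`⟪T(x,y),T(z,v)⟫ + ⟪T(y,z),T(x,v)⟫ + ⟪T(z,x),T(y,v)⟫ = 0`, then `T` satisfies the
Jacobi identity; in particular `(V, T)` is a real Lie algebra with invariant inner
product. -/
theorem bilinear_skew_torsion_jacobi
    {V : Type*} [NormedAddCommGroup V] [InnerProductSpace ℝ V]
    (T : V →ₗ[ℝ] V →ₗ[ℝ] V)
    (halt₁ : ∀ x y z : V, ⟪T x y, z⟫ = -⟪T y x, z⟫)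
    (halt₂ : ∀ x y z : V, ⟪T x y, z⟫ = -⟪T x z, y⟫)
    (hquad : ∀ x y z v : V,
      ⟪T x y, T z v⟫ + ⟪T y z, T x v⟫ + ⟪T z x, T y v⟫ = 0) :
    (∀ x y z : V, T (T x y) z + T (T y z) x + T (T z x) y = 0) ∧
    (∀ x y : V, T x y = -T y x) ∧
    (∀ v w₁ w₂ : V, ⟪T v w₁, w₂⟫ = -⟪w₁, T v w₂⟫) := by
  have hcyc : ∀ a z v : V, ⟪T a z, v⟫ = ⟪a, T z v⟫ := fun a z v => by
    rw [halt₁, halt₂, neg_neg, real_inner_comm]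
  refine ⟨fun x y z => ext_inner_right ℝ fun v => ?_,
    fun x y => ext_inner_right ℝ fun v => ?_, fun v w₁ w₂ => ?_⟩
  · simpa only [inner_add_left, inner_zero_left, hcyc (T _ _)] using hquad x y z v
  · rw [inner_neg_left, halt₁]
  · rw [halt₂, real_inner_comm]
end

section
/- Let V be a finite-dimensional real inner product space, D ⊆ V a linear subspace with orthogonal complement Dᗮ, and R : V × V × V × V → ℝ a multilinear map satisfying, for all x,y,z,v ∈ V: (i) R(x,y,z,v) = −R(y,x,z,v); (ii) R(x,y,z,v) = −R(x,y,v,z); (iii) R(x,y,z,v) + R(y,z,x,v) + R(z,x,y,v) = 0. Assume that R(x,y,z,w) = 0 whenever z ∈ D and w ∈ Dᗮ. Then R(v,w,z,u) = 0 whenever v, w ∈ Dᗮ, z ∈ D, and u ∈ V. -/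
open scoped RealInnerProductSpace

/-- If a curvature-like tensor on a finite-dimensional real inner product space
preserves the subspace `D` (in the sense that `R(x,y,z,w) = 0` whenever `z ∈ D` and
`w ∈ Dᗮ`), then `R(v,w,z,u) = 0` whenever `v, w ∈ Dᗮ`, `z ∈ D`, and `u` is arbitrary. -/
theorem curvature_vanishing_on_mixed_directions
    {V : Type*} [NormedAddCommGroup V] [InnerProductSpace ℝ V] [FiniteDimensional ℝ V]
    (D : Submodule ℝ V)
    (R : V →ₗ[ℝ] V →ₗ[ℝ] V →ₗ[ℝ] V →ₗ[ℝ] ℝ)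
    (hskew₁ : ∀ x y z v : V, R x y z v = -R y x z v)
    (hskew₂ : ∀ x y z v : V, R x y z v = -R x y v z)
    (hbianchi : ∀ x y z v : V, R x y z v + R y z x v + R z x y v = 0)
    (hpres : ∀ x y z w : V, z ∈ D → w ∈ Dᗮ → R x y z w = 0) :
    ∀ v w z u : V, v ∈ Dᗮ → w ∈ Dᗮ → z ∈ D → R v w z u = 0 := by
  intro v w z u hv hw hz
  obtain ⟨a, ha, b, hb, rfl⟩ := D.exists_add_mem_mem_orthogonal u
  have h₁ : R w z v a = 0 := by rw [hskew₂, hpres w z a v ha hv, neg_zero]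
  have h₂ : R z v w a = 0 := by rw [hskew₂, hpres z v a w ha hw, neg_zero]
  have h₃ := hbianchi v w z a
  rw [map_add, hpres v w z b hz hb]
  linarith
end

section
/- Let V be a finite-dimensional real inner product space, D ⊆ V a linear subspace with orthogonal complement Dᗮ, and R : V × V × V × V → ℝ a multilinear map satisfying, for all x,y,z,v ∈ V: (i) R(x,y,z,v) = −R(y,x,z,v); (ii) R(x,y,z,v) = −R(x,y,v,z); (iii) R(x,y,z,v) + R(y,z,x,v) + R(z,x,y,v) = 0. Assume that R(x,y,z,w) = 0 whenever z ∈ D and w ∈ Dᗮ. Then R(v,w,z,u) = 0 whenever v ∈ D, w ∈ Dᗮ, and z, u ∈ V. -/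
open scoped RealInnerProductSpace

/-- A tensor with the algebraic symmetries of a curvature tensor is symmetric under exchange of
its two pairs of arguments. -/
lemma curvature_pair_symm {V : Type*} [AddCommGroup V] [Module ℝ V]
    (R : V →ₗ[ℝ] V →ₗ[ℝ] V →ₗ[ℝ] V →ₗ[ℝ] ℝ)
    (hskew₁ : ∀ x y z v : V, R x y z v = -R y x z v)
    (hskew₂ : ∀ x y z v : V, R x y z v = -R x y v z)
    (hbianchi : ∀ x y z v : V, R x y z v + R y z x v + R z x y v = 0)
    (x y z v : V) : R x y z v = R z v x y := by
  linarith [hbianchi x y z v, hbianchi y z v x, hbianchi z v x y, hbianchi v x y z,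
    hskew₂ x y z v, hskew₂ y z x v, hskew₂ z v x y, hskew₂ v x y z,
    hskew₁ z x y v, hskew₂ x z y v, hskew₁ v y z x, hskew₂ y v z x,
    hskew₁ x z v y, hskew₁ y v x z]

/-- If a curvature-like tensor on a finite-dimensional real inner product space
preserves the subspace `D` (in the sense that `R(x,y,z,w) = 0` whenever `z ∈ D` and
`w ∈ Dᗮ`), then `R(v,w,z,u) = 0` whenever `v ∈ D`, `w ∈ Dᗮ`, and `z, u` are arbitrary. -/
theorem curvature_vanishing_mixed_first_pair
    {V : Type*} [NormedAddCommGroup V] [InnerProductSpace ℝ V] [FiniteDimensional ℝ V]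
    (D : Submodule ℝ V)
    (R : V →ₗ[ℝ] V →ₗ[ℝ] V →ₗ[ℝ] V →ₗ[ℝ] ℝ)
    (hskew₁ : ∀ x y z v : V, R x y z v = -R y x z v)
    (hskew₂ : ∀ x y z v : V, R x y z v = -R x y v z)
    (hbianchi : ∀ x y z v : V, R x y z v + R y z x v + R z x y v = 0)
    (hpres : ∀ x y z w : V, z ∈ D → w ∈ Dᗮ → R x y z w = 0) :
    ∀ v w z u : V, v ∈ D → w ∈ Dᗮ → R v w z u = 0 := by
  intro v w z u hv hw
  rw [curvature_pair_symm R hskew₁ hskew₂ hbianchi]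
  exact hpres z u v w hv hw
end

section
/- Let 𝔤 be a real Lie algebra equipped with an inner product ⟨·,·⟩ that is invariant (⟨[x,y],z⟩ = ⟨x,[y,z]⟩ for all x,y,z ∈ 𝔤), and let J : 𝔤 → 𝔤 be a linear map satisfying J ∘ J = −id, ⟨Jx,Jy⟩ = ⟨x,y⟩ for all x,y, and the integrability condition [Jx,Jy] = [x,y] + J[Jx,y] + J[x,Jy] for all x,y ∈ 𝔤. Define B(x,y,z) := −⟨[x,y],z⟩. Then for all u,v,w ∈ 𝔤: B(u,Jv,Jw) + B(v,Jw,Ju) + B(w,Ju,Jv) = B(u,v,w). -/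
open scoped RealInnerProductSpace

/-! In the theorem below `L` carries two a priori unrelated additive structures, one from the
norm and one from the Lie ring. The lemmas use the addition of the norm; the bracket `b` and the
second addition `p` are plain functions. -/

section InvariantBracket

variable {V : Type*} [NormedAddCommGroup V] [InnerProductSpace ℝ V] {b : V → V → V}

theorem bracket_zero_left_of_invariant (hinv : ∀ x y z : V, ⟪b x y, z⟫ = ⟪x, b y z⟫) (x : V) :
    b 0 x = 0 :=
  ext_inner_right ℝ fun z => by rw [hinv, inner_zero_left, inner_zero_left]

theorem bracket_add_left_of_invariant (hinv : ∀ x y z : V, ⟪b x y, z⟫ = ⟪x, b y z⟫)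
    (x x' y : V) : b (x + x') y = b x y + b x' y :=
  ext_inner_right ℝ fun z => by rw [hinv, inner_add_left, inner_add_left, hinv, hinv]

theorem bracket_add_right_of_invariant (hinv : ∀ x y z : V, ⟪b x y, z⟫ = ⟪x, b y z⟫)
    (x y y' : V) : b x (y + y') = b x y + b x y' :=
  ext_inner_left ℝ fun z => by rw [← hinv, inner_add_right, inner_add_right, hinv, hinv]

theorem bracket_sub_left_of_invariant (hinv : ∀ x y z : V, ⟪b x y, z⟫ = ⟪x, b y z⟫)
    (x x' y : V) : b (x - x') y = b x y - b x' y :=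
  ext_inner_right ℝ fun z => by rw [hinv, inner_sub_left, inner_sub_left, hinv, hinv]

theorem bracket_skew_of_invariant (hinv : ∀ x y z : V, ⟪b x y, z⟫ = ⟪x, b y z⟫)
    (hself : ∀ x, b x x = 0) (x y : V) : b x y = -b y x := by
  have h := hself (x + y)
  rw [bracket_add_left_of_invariant hinv, bracket_add_right_of_invariant hinv,
    bracket_add_right_of_invariant hinv, hself, hself, zero_add, add_zero] at h
  exact eq_neg_of_add_eq_zero_left h

/-- A second commutative addition over which an invariant bracket distributes agrees with the
given one modulo the center. -/
theorem bracket_eq_bracket_add_of_invariant (hinv : ∀ x y z : V, ⟪b x y, z⟫ = ⟪x, b y z⟫)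
    (hself : ∀ x, b x x = 0) {p : V → V → V} (hcomm : ∀ x y, p x y = p y x)
    (hzero : ∀ x, p 0 x = x) (hp : ∀ x x' y, b (p x x') y = p (b x y) (b x' y)) (x x' y : V) :
    b (p x x') y = b (x + x') y := by
  have hadd := bracket_add_left_of_invariant hinv
  have hadd' := bracket_add_right_of_invariant hinv
  have hskew := bracket_skew_of_invariant hinv hself
  let d : V → V → V := fun x x' => p x x' - (x + x')
  have hdcomm (x x' : V) : d x x' = d x' x := by
    simp only [d, hcomm x x', add_comm x x']
  have hdzero (x : V) : d 0 x = 0 := by simp [d, hzero]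
  have hd (x x' y : V) : b (d x x') y = d (b x y) (b x' y) := by
    simp only [d, bracket_sub_left_of_invariant hinv, hp, hadd]
  have hdself (x x' : V) : b (d x x') x = 0 := by rw [hd, hself, hdzero]
  have hanti (x x' y : V) : b (d y x') x = -b (d x x') y := by
    have hy : b (d (x + y) x') y = b (d x x') y := by
      rw [hd, hadd, hself, add_zero, ← hd]
    have hx : b (d (x + y) x') x = b (d y x') x := by
      rw [hd, hadd, hself, zero_add, ← hd]
    have h := hdself (x + y) x'
    rw [hadd', hx, hy] at h
    exact eq_neg_of_add_eq_zero_left h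
  -- antisymmetric under one transposition of its arguments and symmetric under another
  have hzero' : b (d x x') y = 0 := by
    have h : b (d x x') y = -b (d x x') y := by
      calc b (d x x') y = -b (d y x') x := hanti y x' x
        _ = -b (d x' y) x := by rw [hdcomm]
        _ = b (d x y) x' := by rw [hanti x y x', neg_neg]
        _ = b (d y x) x' := by rw [hdcomm]
        _ = -b (d x' x) y := hanti x' x y
        _ = -b (d x x') y := by rw [hdcomm]
    have : IsAddTorsionFree V := .of_isTorsionFree ℝ V
    exact self_eq_neg.mp h
  rw [← sub_eq_zero, ← bracket_sub_left_of_invariant hinv]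
  exact hzero'

/-- An involution preserving the inner product with no nonzero fixed vector is negation. -/
theorem eq_neg_of_inner_map_map_of_involutive {n : V → V} (hn : ∀ x y : V, ⟪n x, n y⟫ = ⟪x, y⟫)
    (hnn : ∀ x, n (n x) = x) (hfix : ∀ x, n x = x → x = 0) (x : V) : n x = -x := by
  have hsymm (x y : V) : ⟪n x, y⟫ = ⟪x, n y⟫ := by rw [← hn, hnn]
  refine eq_neg_of_add_eq_zero_left (hfix _ (ext_inner_right ℝ fun z => ?_))
  rw [hsymm, inner_add_left, inner_add_left, hn, hsymm, add_comm]

/-- Integrability of an orthogonal complex structure with respect to a second addition `p`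
implies integrability with respect to the given one. -/
theorem integrable_add_of_invariant (hinv : ∀ x y z : V, ⟪b x y, z⟫ = ⟪x, b y z⟫)
    (hself : ∀ x, b x x = 0) {p : V → V → V} (hcomm : ∀ x y, p x y = p y x)
    (hzero : ∀ x, p 0 x = x) (hp : ∀ x x' y, b (p x x') y = p (b x y) (b x' y))
    {J : V → V} (hJ : ∀ x y : V, ⟪J x, y⟫ = -⟪x, J y⟫)
    (hint : ∀ x y, b (J x) (J y) = p (p (b x y) (J (b (J x) y))) (J (b x (J y)))) (x y : V) :
    b (J x) (J y) = b x y + J (b (J x) y) + J (b x (J y)) := by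
  have hadd := bracket_eq_bracket_add_of_invariant hinv hself hcomm hzero hp
  have hskew := bracket_skew_of_invariant hinv hself
  have hJzero : J 0 = 0 := ext_inner_right ℝ fun z => by simp [hJ]
  set e := b (J x) (J y) - (b x y + J (b (J x) y) + J (b x (J y))) with he
  have hcent (w : V) : b e w = 0 := by
    rw [he, bracket_sub_left_of_invariant hinv, hint, hadd, bracket_add_left_of_invariant hinv,
      hadd, ← bracket_add_left_of_invariant hinv, sub_self]
  have hJe (w : V) : b (J e) (J w) = J (b (J e) w) := by
    rw [hint, hcent, hcent, hJzero, hzero, hcomm, hzero]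
  have horth (x y : V) : ⟪b x y, e⟫ = 0 := by
    rw [hinv, hskew, hcent, neg_zero, inner_zero_right]
  have h₁ : ⟪J (b (J x) y), e⟫ = ⟪J x, b (J e) y⟫ := by
    rw [hJ, hinv, hskew y, inner_neg_right, neg_neg]
  have h₂ : ⟪J (b x (J y)), e⟫ = -⟪J x, b (J e) y⟫ := by
    rw [hJ, hinv, hskew (J y), hJe, inner_neg_right, hJ]
  refine sub_eq_zero.mp (inner_self_eq_zero (𝕜 := ℝ).mp ?_)
  rw [← he]
  nth_rewrite 1 [he]
  rw [inner_sub_left, inner_add_left, inner_add_left, horth, horth, h₁, h₂]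
  ring

end InvariantBracket

/-- On a real Lie algebra equipped with an invariant inner product and an orthogonal
linear complex structure `J`, the 3-form `B(x,y,z) = -⟪[x,y],z⟫` satisfies
`B(u,Jv,Jw) + B(v,Jw,Ju) + B(w,Ju,Jv) = B(u,v,w)`. -/
theorem cartan_form_J_identity
    {L : Type*} [NormedAddCommGroup L] [InnerProductSpace ℝ L]
    [LieRing L] [LieAlgebra ℝ L]
    (hinv : ∀ x y z : L, ⟪⁅x, y⁆, z⟫ = ⟪x, ⁅y, z⁆⟫)
    (J : L →ₗ[ℝ] L)
    (hJ2 : ∀ x : L, J (J x) = -x)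
    (hJorth : ∀ x y : L, ⟪J x, J y⟫ = ⟪x, y⟫)
    (hint : ∀ x y : L, ⁅J x, J y⁆ = ⁅x, y⁆ + J ⁅J x, y⁆ + J ⁅x, J y⁆)
    (B : L → L → L → ℝ)
    (hB : ∀ x y z : L, B x y z = -⟪⁅x, y⁆, z⟫) :
    ∀ u v w : L,
      B u (J v) (J w) + B v (J w) (J u) + B w (J u) (J v) = B u v w := by
  have hz := (bracket_zero_left_of_invariant hinv _).symm.trans (lie_self _)
  have hself (x : L) := (lie_self x).trans hz.symm
  have : IsAddTorsionFree L := .of_isTorsionFree ℝ L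
  have hneg := eq_neg_of_inner_map_map_of_involutive (V := L)
    (fun x y => by rw [← hJ2, ← hJ2, hJorth, hJorth]) neg_neg
    (fun x hx => (self_eq_neg.mp hx.symm).trans hz.symm)
  have hJ (x y : L) : ⟪J x, y⟫ = -⟪x, J y⟫ := by
    rw [← hJorth, hJ2, hneg, inner_neg_left]
  have hint' := integrable_add_of_invariant hinv hself add_comm
    (fun x => by rw [hz, zero_add]) add_lie hJ hint
  intro u v w
  have h := congrArg (fun x => ⟪u, x⟫) (hint' v w)
  simp only [inner_add_right] at h
  have h₁ : ⟪⁅v, J w⁆, J u⟫ = -⟪u, J ⁅v, J w⁆⟫ := by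
    rw [real_inner_comm, hJ]
  have h₂ : ⟪⁅w, J u⁆, J v⟫ = -⟪u, J ⁅J v, w⁆⟫ := by
    rw [real_inner_comm, ← hinv, real_inner_comm, hJ]
  rw [hB, hB, hB, hB, h₁, h₂, hinv, hinv, h]
  ring
end
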